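/- Let k be a perfect field such that for every positive integer m there are only finitely many intermediate fields of the extension k̄/k (k̄ an algebraic closure of k) of degree m over k, and let n be a positive integer such that the characteristic of k is zero or does not divide n. Then the group SL_n(k) has only finitely many z-classes. -/

import Mathlib

/-- Two elements of a group are *z-equivalent* if their centralizers are conjugate:
there is `a` with `a ⬝ Z(g) ⬝ a⁻¹ = Z(h)`. -/
def IsZEquiv {G : Type*} [Group G] (g h : G) : Prop :=
  ∃ a : G, ∀ x : G, x ∈ Subgroup.centralizer {g} ↔ a * x * a⁻¹ ∈ Subgroup.centralizer {h}

section

open Polynomial Module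

/-- If `α ∈ k(β)`, then there is a polynomial `q` such that the minimal polynomial of `β` divides
`minpoly k α ∘ q` exactly once. -/
theorem exists_comp_dvd_not_sq_dvd {k E : Type*} [Field k] [PerfectField k] [Field E] [Algebra k E]
    {α β : E} (hβ : IsIntegral k β) (hα : IsIntegral k α) (h : α ∈ IntermediateField.adjoin k {β}) :
    ∃ q : k[X], minpoly k β ∣ (minpoly k α).comp q ∧ ¬ minpoly k β ^ 2 ∣ (minpoly k α).comp q := by
  have hr : ∃ r : k[X], aeval β r = α := by
    have h2 : α ∈ (IntermediateField.adjoin k {β}).toSubalgebra := h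
    rw [IntermediateField.adjoin_simple_toSubalgebra_of_isAlgebraic hβ.isAlgebraic,
      Algebra.adjoin_singleton_eq_range_aeval] at h2
    exact h2
  obtain ⟨r, hr⟩ := hr
  have hroot (q : k[X]) (hq : aeval β q = α) : minpoly k β ∣ (minpoly k α).comp q :=
    minpoly.dvd k β (by rw [aeval_comp, hq, minpoly.aeval])
  by_cases h2 : minpoly k β ^ 2 ∣ (minpoly k α).comp r
  · refine ⟨r + minpoly k β, hroot _ (by simp [hr]), fun h3 ↦ ?_⟩
    obtain ⟨c, hc⟩ := binomExpansion ((minpoly k α).map C) r (minpoly k β)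
    rw [eval_map, eval_map, derivative_map, eval_map] at hc
    change (minpoly k α).comp _ = (minpoly k α).comp r + (derivative (minpoly k α)).comp r * _ + _
      at hc
    rw [hc, dvd_add_left (Dvd.intro_left c rfl), dvd_add_right h2, sq] at h3
    have h4 := (mul_dvd_mul_iff_right (minpoly.ne_zero hβ)).1 h3
    have h5 : aeval β ((derivative (minpoly k α)).comp r) = 0 := by
      obtain ⟨s, hs⟩ := h4
      simp [hs]
    rw [aeval_comp, hr] at h5
    exact (PerfectField.separable_of_irreducible (minpoly.irreducible hα)).aeval_derivative_ne_zero
      (minpoly.aeval k α) h5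
  · exact ⟨r, hroot r hr, h2⟩

theorem Polynomial.sub_dvd_comp_sub_comp {R : Type*} [CommRing R] (p q r : R[X]) :
    q - r ∣ p.comp q - p.comp r := by
  simpa [comp, eval_map] using sub_dvd_eval_sub q r (p.map C)

/-- If `p` and `p'` are irreducible of the same degree and `p'` divides `p ∘ q` exactly once, then
`X ↦ q` induces an isomorphism from `k[X] / (p ^ e)` to `k[X] / (p' ^ e)`. -/
theorem AdjoinRoot.exists_linearEquiv_pow {k : Type*} [Field k] {p p' q : k[X]}
    (hp : Irreducible p) (hp' : Irreducible p') (hdeg : p.natDegree = p'.natDegree)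
    (h1 : p' ∣ p.comp q) (h2 : ¬ p' ^ 2 ∣ p.comp q) (e : ℕ) :
    ∃ φ : AdjoinRoot (p ^ e) ≃ₗ[k] AdjoinRoot (p' ^ e),
      ∀ x, φ (AdjoinRoot.root (p ^ e) * x) = AdjoinRoot.mk (p' ^ e) q * φ x := by
  have h0 : aeval (AdjoinRoot.mk (p' ^ e) q) (p ^ e) = 0 := by
    rw [← AdjoinRoot.aeval_eq, ← aeval_comp, AdjoinRoot.aeval_eq, AdjoinRoot.mk_eq_zero, pow_comp]
    exact pow_dvd_pow_of_dvd h1 e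
  let f : AdjoinRoot (p ^ e) →ₐ[k] AdjoinRoot (p' ^ e) :=
    AdjoinRoot.liftAlgHom (p ^ e) (Algebra.ofId k _) (AdjoinRoot.mk (p' ^ e) q) h0
  have hfr : f (AdjoinRoot.root (p ^ e)) = AdjoinRoot.mk (p' ^ e) q :=
    AdjoinRoot.liftAlgHom_root _ _ _ _
  have hinj : Function.Injective f := by
    rw [injective_iff_map_eq_zero]
    intro x hx
    obtain ⟨s, rfl⟩ := AdjoinRoot.mk_surjective x
    by_cases hs0 : s = 0
    · simp [hs0]
    rw [← AdjoinRoot.aeval_eq, ← aeval_algHom_apply, hfr, ← AdjoinRoot.aeval_eq, ← aeval_comp,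
      AdjoinRoot.aeval_eq, AdjoinRoot.mk_eq_zero] at hx
    rw [AdjoinRoot.mk_eq_zero]
    obtain ⟨n, t, ht, rfl⟩ := WfDvdMonoid.max_power_factor hs0 hp
    refine dvd_mul_of_dvd_left (pow_dvd_pow p ?_) t
    obtain ⟨c, hc⟩ := h1
    have hc' : ¬ p' ∣ c := fun h ↦ h2 (by rw [hc, sq]; exact mul_dvd_mul_left _ h)
    have ht' : ¬ p' ∣ t.comp q := by
      intro h
      obtain ⟨a, b, hab⟩ := (hp.coprime_iff_not_dvd).2 ht
      have := congrArg (fun u ↦ u.comp q) hab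
      simp only [add_comp, mul_comp, one_comp] at this
      refine hp'.not_isUnit (isUnit_of_dvd_one (this ▸ dvd_add ?_ (h.mul_left _)))
      exact Dvd.dvd.mul_left (hc ▸ dvd_mul_right _ _) _
    rw [mul_comp, pow_comp, hc, mul_pow, mul_assoc] at hx
    by_contra hn
    push Not at hn
    obtain ⟨d, rfl⟩ := Nat.exists_eq_add_of_lt hn
    rw [add_assoc, pow_add, mul_dvd_mul_iff_left (pow_ne_zero _ hp'.ne_zero)] at hx
    have h3 : p' ∣ c ^ n * t.comp q := (dvd_pow_self p' (by omega)).trans hx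
    rcases hp'.prime.dvd_or_dvd h3 with h | h
    · exact hc' (hp'.prime.dvd_of_dvd_pow h)
    · exact ht' h
  have hfd {u : k[X]} (hu : Irreducible u) : FiniteDimensional k (AdjoinRoot (u ^ e)) :=
    (AdjoinRoot.powerBasis (pow_ne_zero e hu.ne_zero)).finite
  have := hfd hp
  have := hfd hp'
  have hrank : finrank k (AdjoinRoot (p ^ e)) = finrank k (AdjoinRoot (p' ^ e)) := by
    have h (u : k[X]) : finrank k (AdjoinRoot u) = u.natDegree :=
      finrank_quotient_span_eq_natDegree
    rw [h, h, natDegree_pow, natDegree_pow, hdeg]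
  refine ⟨LinearMap.linearEquivOfInjective f.toLinearMap hinj hrank, fun x ↦ ?_⟩
  change f _ = _ * f x
  rw [map_mul, hfr]

theorem AdjoinRoot.finrank_eq_natDegree {k : Type*} [Field k] (u : k[X]) :
    finrank k (AdjoinRoot u) = u.natDegree :=
  finrank_quotient_span_eq_natDegree

/-- The primary decomposition of a finite-dimensional `k[X]`-module, with the irreducible factors
given as minimal polynomials of chosen elements of the algebraic closure. -/
theorem Module.End.exists_linearEquiv_pi_adjoinRoot {k V : Type*} [Field k] [AddCommGroup V]
    [Module k V] [FiniteDimensional k V] (g : Module.End k V) :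
    ∃ (r : ℕ) (α : Fin r → AlgebraicClosure k) (e : Fin r → ℕ), (∀ i, e i ≠ 0) ∧
      (∀ i j, minpoly k (α i) = minpoly k (α j) → α i = α j) ∧
      ∃ φ : V ≃ₗ[k] ∀ i, AdjoinRoot (minpoly k (α i) ^ e i),
        ∀ v i, φ (g v) i = AdjoinRoot.root _ * φ v i := by
  classical
  obtain ⟨ι, _, p, hp, e, ⟨ψ⟩⟩ := Module.equiv_directSum_of_isTorsion
    (Module.AEval.isTorsion_of_finiteDimensional k V g)
  have hroot (f : k[X]) : ∃ a : AlgebraicClosure k, Irreducible f → aeval a f = 0 := by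
    by_cases hf : Irreducible f
    · obtain ⟨a, ha⟩ := IsAlgClosed.exists_aeval_eq_zero (AlgebraicClosure k) f hf.degree_pos.ne'
      exact ⟨a, fun _ ↦ ha⟩
    · exact ⟨0, fun h ↦ absurd h hf⟩
  choose ρ hρ using hroot
  let m (i : ι) : k[X] := p i * C (p i).leadingCoeff⁻¹
  have hmirr (i : ι) : Irreducible (m i) := irreducible_mul_leadingCoeff_inv.2 (hp i)
  have hm (i : ι) : minpoly k (ρ (m i)) = m i :=
    (minpoly.eq_of_irreducible_of_monic (hmirr i) (hρ _ (hmirr i))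
      (monic_mul_leadingCoeff_inv (hp i).ne_zero)).symm
  have hspan (i : ι) : Submodule.span k[X] {p i ^ e i} =
      Ideal.span {minpoly k (ρ (m i)) ^ e i} := by
    rw [hm]
    refine Ideal.span_singleton_eq_span_singleton.2 (Associated.pow_pow ?_)
    refine associated_mul_unit_right _ _ (isUnit_C.2 ?_)
    simpa using (hp i).ne_zero
  let σ := {i : ι // e i ≠ 0}
  let ε : Fin (Fintype.card σ) ≃ σ := (Fintype.equivFin σ).symm
  let χ (i : ι) : (k[X] ⧸ Submodule.span k[X] {p i ^ e i}) ≃ₗ[k[X]]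
      (k[X] ⧸ Ideal.span {minpoly k (ρ (m i)) ^ e i}) := Submodule.quotEquivOfEq _ _ (hspan i)
  let ψ' : AEval' g ≃ₗ[k[X]] ∀ i : ι, k[X] ⧸ Ideal.span {minpoly k (ρ (m i)) ^ e i} :=
    ψ ≪≫ₗ DirectSum.linearEquivFunOnFintype k[X] ι _ ≪≫ₗ LinearEquiv.piCongrRight χ
  have hsub (i : ι) (hi : e i = 0) : Subsingleton (AdjoinRoot (minpoly k (ρ (m i)) ^ e i)) := by
    rw [hi, pow_zero]
    exact Ideal.Quotient.subsingleton_iff.2 (Ideal.span_singleton_one)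
  let θ : V →ₗ[k] ∀ j, AdjoinRoot (minpoly k (ρ (m (ε j).1)) ^ e (ε j).1) :=
    { toFun v j := ψ' (AEval'.of g v) (ε j).1
      map_add' v w := funext fun j ↦ congrFun (map_add ψ' (AEval'.of g v) (AEval'.of g w)) _
      map_smul' c v := by
        have h : ψ' (AEval'.of g (c • v)) = (C c : k[X]) • ψ' (AEval'.of g v) := by
          rw [map_smul, ← AEval.C_smul, map_smul]
        exact funext fun j ↦ (congrFun h _).trans (Algebra.smul_def
          (A := AdjoinRoot (minpoly k (ρ (m (ε j).1)) ^ e (ε j).1)) c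
          (ψ' (AEval'.of g v) (ε j).1)).symm }
  have hθ : Function.Bijective θ := by
    constructor
    · intro v w h
      refine (AEval'.of g).injective (ψ'.injective (funext fun i ↦ ?_))
      by_cases hi : e i = 0
      · exact (hsub i hi).elim _ _
      · have := congrFun h (ε.symm ⟨i, hi⟩)
        change ψ' (AEval'.of g v) (ε _).1 = ψ' (AEval'.of g w) (ε _).1 at this
        have h4 : (ε (ε.symm ⟨i, hi⟩)).1 = i := by simp
        rw [h4] at this
        exact this
    · intro y
      have hy : ∃ z : ∀ i : ι, AdjoinRoot (minpoly k (ρ (m i)) ^ e i), ∀ j, z (ε j).1 = y j := by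
        refine ⟨fun i ↦ if hi : e i = 0 then 0 else
          cast (by simp) (y (ε.symm ⟨i, hi⟩)), fun j ↦ ?_⟩
        dsimp only
        rw [dif_neg (ε j).2]
        apply eq_of_heq
        exact (cast_heq _ _).trans (congr_arg_heq y (ε.symm_apply_apply j))
      obtain ⟨z, hz⟩ := hy
      obtain ⟨v, hv⟩ := ψ'.surjective z
      exact ⟨v, funext fun j ↦ (congrFun hv _).trans (hz j)⟩
  refine ⟨_, fun j ↦ ρ (m (ε j).1), fun j ↦ e (ε j).1, fun j ↦ (ε j).2, ?_,
    LinearEquiv.ofBijective θ hθ, fun v j ↦ ?_⟩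
  · intro i j h
    dsimp only at h ⊢
    rw [hm, hm] at h
    rw [h]
  · have h : ψ' (AEval'.of g (g v)) = (X : k[X]) • ψ' (AEval'.of g v) := by
      rw [← AEval'.X_smul_of, map_smul]
    exact congrFun h _

/-- Two endomorphisms whose elementary divisors have the same exponents and the same root fields,
with compatible coincidences between roots, are similar up to applying a polynomial. -/
theorem Module.End.exists_intertwining_aeval {k V : Type*} [Field k] [PerfectField k]
    [AddCommGroup V] [Module k V] {g h : Module.End k V} {r : ℕ}
    {α β : Fin r → AlgebraicClosure k} {e : Fin r → ℕ}
    (hβ : ∀ i j, minpoly k (β i) = minpoly k (β j) → β i = β j)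
    (hαβ : ∀ i j, β i = β j → α i = α j)
    (hadj : ∀ i, IntermediateField.adjoin k {α i} = IntermediateField.adjoin k {β i})
    (φ : V ≃ₗ[k] ∀ i, AdjoinRoot (minpoly k (α i) ^ e i))
    (hφ : ∀ v i, φ (g v) i = AdjoinRoot.root _ * φ v i)
    (ψ : V ≃ₗ[k] ∀ i, AdjoinRoot (minpoly k (β i) ^ e i))
    (hψ : ∀ v i, ψ (h v) i = AdjoinRoot.root _ * ψ v i) :
    ∃ (q : k[X]) (Φ : V ≃ₗ[k] V), ∀ v, Φ (g v) = aeval h q (Φ v) := by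
  classical
  have hint (x : AlgebraicClosure k) : IsIntegral k x := Algebra.IsIntegral.isIntegral x
  have hirr (x : AlgebraicClosure k) : Irreducible (minpoly k x) := minpoly.irreducible (hint x)
  obtain ⟨F, hF⟩ := (Function.factorsThrough_iff (f := β) α).1 fun i j ↦ hαβ i j
  have hF (i : Fin r) : F (β i) = α i := (congrFun hF i).symm
  choose q₀ hq₀ hq₀' using fun i ↦ exists_comp_dvd_not_sq_dvd (hint (β i)) (hint (α i))
    (hadj i ▸ IntermediateField.mem_adjoin_simple_self k (α i))
  obtain ⟨Q, hQ⟩ : ∃ Q : AlgebraicClosure k → k[X], ∀ b ∈ Finset.univ.image β,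
      minpoly k b ∣ (minpoly k (F b)).comp (Q b) ∧
      ¬ minpoly k b ^ 2 ∣ (minpoly k (F b)).comp (Q b) := by
    have : ∀ b, ∃ q : k[X], b ∈ Finset.univ.image β →
        minpoly k b ∣ (minpoly k (F b)).comp q ∧ ¬ minpoly k b ^ 2 ∣ (minpoly k (F b)).comp q := by
      intro b
      by_cases hb : b ∈ Finset.univ.image β
      · obtain ⟨i, -, rfl⟩ := Finset.mem_image.1 hb
        exact ⟨q₀ i, fun _ ↦ by rw [hF]; exact ⟨hq₀ i, hq₀' i⟩⟩
      · exact ⟨0, fun h ↦ absurd h hb⟩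
    choose Q hQ using this
    exact ⟨Q, hQ⟩
  obtain ⟨q, hq⟩ := IsDedekindDomain.exists_forall_sub_mem_ideal (s := Finset.univ.image β)
    (fun b ↦ Ideal.span {minpoly k b}) (fun _ ↦ 2)
    (fun b _ ↦ by
      rw [Ideal.prime_iff_isPrime (by simpa using (hirr b).ne_zero)]
      exact (Ideal.span_singleton_prime (hirr b).ne_zero).2 (hirr b).prime)
    (fun b hb c hc hbc heq ↦ by
      obtain ⟨i, -, rfl⟩ := Finset.mem_image.1 hb
      obtain ⟨j, -, rfl⟩ := Finset.mem_image.1 hc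
      exact hbc (hβ i j (eq_of_monic_of_associated (minpoly.monic (hint _))
        (minpoly.monic (hint _)) (Ideal.span_singleton_eq_span_singleton.1 heq))))
    (fun b ↦ Q b)
  have hdvd (i : Fin r) : minpoly k (β i) ∣ (minpoly k (α i)).comp q ∧
      ¬ minpoly k (β i) ^ 2 ∣ (minpoly k (α i)).comp q := by
    have hi := Finset.mem_image_of_mem β (Finset.mem_univ i)
    have h1 := hQ _ hi
    have h2 := hq _ hi
    rw [Ideal.span_singleton_pow, Ideal.mem_span_singleton] at h2
    have h3 := h2.trans (sub_dvd_comp_sub_comp (minpoly k (F (β i))) q (Q (β i)))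
    rw [hF] at h1 h3
    rw [dvd_iff_dvd_of_dvd_sub h3,
      dvd_iff_dvd_of_dvd_sub ((dvd_pow_self _ two_ne_zero).trans h3)]
    exact h1
  have hdeg (i : Fin r) : (minpoly k (α i)).natDegree = (minpoly k (β i)).natDegree := by
    rw [← IntermediateField.adjoin.finrank (hint _), hadj,
      IntermediateField.adjoin.finrank (hint _)]
  choose χ hχ using fun i ↦ AdjoinRoot.exists_linearEquiv_pow (hirr (α i)) (hirr (β i)) (hdeg i)
    (hdvd i).1 (hdvd i).2 (e i)
  have haeval (f : k[X]) (v : V) (i : Fin r) :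
      ψ (aeval h f v) i = AdjoinRoot.mk _ f * ψ v i := by
    induction f using Polynomial.induction_on' generalizing v with
    | add f g hf hg => simp [hf, hg, add_mul]
    | monomial n a =>
      induction n generalizing v with
      | zero => simp [Algebra.smul_def]
      | succ n ih =>
        rw [← monomial_mul_X, map_mul, aeval_X, Module.End.mul_apply, ih, hψ, map_mul,
          AdjoinRoot.mk_X, mul_assoc]
  refine ⟨q, φ ≪≫ₗ LinearEquiv.piCongrRight χ ≪≫ₗ ψ.symm, fun v ↦ ψ.injective (funext fun i ↦ ?_)⟩
  rw [haeval]
  simp [hφ, hχ]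

/-- If each of `g` and `h` is similar to a polynomial in the other, then any similarity between `g`
and a polynomial in `h` conjugates the centralizer of `g` onto that of `h`. -/
theorem Module.End.commute_iff_of_intertwining_aeval {k V : Type*} [Field k] [AddCommGroup V]
    [Module k V] [FiniteDimensional k V] {g h : Module.End k V} {p q : k[X]} {Φ Ψ : V ≃ₗ[k] V}
    (hΦ : ∀ v, Φ (g v) = aeval h q (Φ v)) (hΨ : ∀ v, Ψ (h v) = aeval g p (Ψ v))
    (x : Module.End k V) : Commute x g ↔ Commute (Φ.conj x) h := by
  have key {g h : Module.End k V} {q : k[X]} {Φ : V ≃ₗ[k] V}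
      (hΦ : ∀ v, Φ (g v) = aeval h q (Φ v)) {x : Module.End k V} (hx : Commute (Φ.conj x) h) :
      Commute x g := by
    have h1 : Φ.conj g = aeval h q := by
      ext v
      simp [LinearEquiv.conj_apply, hΦ]
    have h2 : Commute (Φ.conj x) (Φ.conj g) := by
      rw [h1]
      exact (Algebra.commute_of_mem_adjoin_singleton_of_commute (R := k)
        (aeval_mem_adjoin_singleton k h) hx)
    apply Φ.conj.injective
    rw [Module.End.mul_eq_comp, Module.End.mul_eq_comp, LinearEquiv.conj_comp,
      LinearEquiv.conj_comp]
    exact h2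
  have hmem (g y : Module.End k V) :
      y ∈ (Subalgebra.centralizer k {g}).toSubmodule ↔ Commute y g := by
    rw [Subalgebra.mem_toSubmodule, Subalgebra.mem_centralizer_iff]
    simp only [Set.mem_singleton_iff, forall_eq]
    exact eq_comm
  have hle {g h : Module.End k V} {q : k[X]} {Φ : V ≃ₗ[k] V}
      (hΦ : ∀ v, Φ (g v) = aeval h q (Φ v)) :
      (Subalgebra.centralizer k {h}).toSubmodule.map (Φ.conj.symm : _ →ₗ[k] _) ≤
        (Subalgebra.centralizer k {g}).toSubmodule := by
    rintro _ ⟨y, hy, rfl⟩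
    rw [SetLike.mem_coe, hmem] at hy
    refine (hmem _ _).2 (key hΦ ?_)
    rwa [LinearEquiv.coe_coe, LinearEquiv.apply_symm_apply]
  have hrank {g h : Module.End k V} {q : k[X]} {Φ : V ≃ₗ[k] V}
      (hΦ : ∀ v, Φ (g v) = aeval h q (Φ v)) :
      finrank k (Subalgebra.centralizer k {h}).toSubmodule ≤
        finrank k (Subalgebra.centralizer k {g}).toSubmodule := by
    rw [← LinearEquiv.finrank_map_eq Φ.conj.symm]
    exact Submodule.finrank_mono (hle hΦ)
  refine ⟨fun hx ↦ ?_, key hΦ⟩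
  have heq := Submodule.eq_of_le_of_finrank_le (hle hΦ)
    ((hrank hΨ).trans (LinearEquiv.finrank_map_eq Φ.conj.symm _).ge)
  rw [← hmem, ← heq] at hx
  obtain ⟨y, hy, rfl⟩ := hx
  rwa [LinearEquiv.coe_coe, LinearEquiv.apply_symm_apply, ← hmem]

/-- Over a perfect field of type (F), the endomorphisms of `V` fall into finitely many sets within
which centralizers are conjugate under `GL(V)`. -/
theorem Module.End.exists_finite_cover_of_typeF {k V : Type*} [Field k] [PerfectField k]
    [AddCommGroup V] [Module k V] [FiniteDimensional k V]
    (hk : ∀ m : ℕ, 0 < m →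
      {K : IntermediateField k (AlgebraicClosure k) | Module.finrank k K = m}.Finite) :
    ∃ (s : Set (Set (Module.End k V))), s.Finite ∧ ⋃₀ s = Set.univ ∧ ∀ t ∈ s, ∀ g ∈ t, ∀ h ∈ t,
      ∃ Φ : V ≃ₗ[k] V, ∀ x, Commute x g ↔ Commute (Φ.conj x) h := by
  let n := finrank k V
  let F : Set (IntermediateField k (AlgebraicClosure k)) := ⋃ m ∈ Set.Icc 1 n, {K | finrank k K = m}
  have hF : F.Finite := (Set.finite_Icc 1 n).biUnion fun m hm ↦ hk m hm.1
  have := hF.to_subtype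
  let D := Σ r : Fin (n + 1), (Fin r → Fin (n + 1)) × (Fin r → F) × (Fin r → Fin r → Prop)
  let T (d : D) : Set (Module.End k V) := {g | ∃ α : Fin d.1 → AlgebraicClosure k,
    (∀ i j, minpoly k (α i) = minpoly k (α j) → α i = α j) ∧
    (∀ i, IntermediateField.adjoin k {α i} = d.2.2.1 i) ∧
    (∀ i j, α i = α j ↔ d.2.2.2 i j) ∧
    ∃ φ : V ≃ₗ[k] ∀ i, AdjoinRoot (minpoly k (α i) ^ (d.2.1 i : ℕ)),
        ∀ v i, φ (g v) i = AdjoinRoot.root _ * φ v i}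
  refine ⟨Set.range T, Set.finite_range T, ?_, ?_⟩
  · refine Set.eq_univ_of_forall fun g ↦ ?_
    obtain ⟨r, α, e, he, hα, φ, hφ⟩ := g.exists_linearEquiv_pi_adjoinRoot
    have hint (i : Fin r) : IsIntegral k (α i) := Algebra.IsIntegral.isIntegral _
    have hfd (i : Fin r) : FiniteDimensional k (AdjoinRoot (minpoly k (α i) ^ e i)) :=
      (AdjoinRoot.powerBasis (pow_ne_zero _ (minpoly.ne_zero (hint i)))).finite
    have hn : n = ∑ i, e i * (minpoly k (α i)).natDegree := by
      simp only [n]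
      rw [LinearEquiv.finrank_eq φ, finrank_pi_fintype]
      exact Finset.sum_congr rfl fun i _ ↦ by
        rw [AdjoinRoot.finrank_eq_natDegree, natDegree_pow]
    have hpos (i : Fin r) : 0 < (minpoly k (α i)).natDegree := minpoly.natDegree_pos (hint i)
    have hle (i : Fin r) : e i * (minpoly k (α i)).natDegree ≤ n :=
      hn ▸ Finset.single_le_sum (f := fun i ↦ e i * (minpoly k (α i)).natDegree)
        (fun _ _ ↦ Nat.zero_le _) (Finset.mem_univ i)
    have hr : r ≤ n := by
      rw [hn]
      calc r = ∑ i : Fin r, 1 := by simp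
        _ ≤ _ := Finset.sum_le_sum fun i _ ↦ Nat.mul_pos (Nat.pos_of_ne_zero (he i)) (hpos i)
    refine ⟨_, ⟨⟨⟨r, Nat.lt_succ_of_le hr⟩,
      fun i ↦ ⟨e i, Nat.lt_succ_of_le ((Nat.le_mul_of_pos_right _ (hpos i)).trans (hle i))⟩,
      fun i ↦ ⟨IntermediateField.adjoin k {α i}, ?_⟩, fun i j ↦ α i = α j⟩, rfl⟩,
      α, hα, fun i ↦ rfl, fun i j ↦ Iff.rfl, φ, hφ⟩
    have := (Nat.le_mul_of_pos_left _ (Nat.pos_of_ne_zero (he i))).trans (hle i)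
    simp only [F, Set.mem_iUnion]
    exact ⟨_, ⟨hpos i, this⟩, IntermediateField.adjoin.finrank (hint i)⟩
  · rintro _ ⟨d, rfl⟩ g ⟨α, hα, hαK, hαS, φ, hφ⟩ h ⟨β, hβ, hβK, hβS, ψ, hψ⟩
    obtain ⟨q, Φ, hΦ⟩ := exists_intertwining_aeval hβ (fun i j hij ↦ (hαS i j).2 ((hβS i j).1 hij))
      (fun i ↦ (hαK i).trans (hβK i).symm) φ hφ ψ hψ
    obtain ⟨p, Ψ, hΨ⟩ := exists_intertwining_aeval hα (fun i j hij ↦ (hβS i j).2 ((hαS i j).1 hij))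
      (fun i ↦ (hβK i).trans (hαK i).symm) ψ hψ φ hφ
    exact ⟨Φ, commute_iff_of_intertwining_aeval hΦ hΨ⟩

end

/-- Over a perfect field of type (F), the `n`-th powers have finite index in the unit group. -/
theorem Units.finiteIndex_powMonoidHom_of_typeF {k : Type*} [Field k] [PerfectField k]
    (hk : ∀ m : ℕ, 0 < m →
      {K : IntermediateField k (AlgebraicClosure k) | Module.finrank k K = m}.Finite)
    {n : ℕ} (hn : 0 < n) : ((powMonoidHom n : kˣ →* kˣ).range).FiniteIndex := by
  have : NeZero n := ⟨hn.ne'⟩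
  let F : Set (IntermediateField k (AlgebraicClosure k)) :=
    ⋃ m ∈ Set.Icc 1 n, {K | Module.finrank k K = m}
  have hF : F.Finite := (Set.finite_Icc 1 n).biUnion fun m hm ↦ hk m hm.1
  have := hF.to_subtype
  have (K : F) : FiniteDimensional k K.1 := by
    obtain ⟨m, hm, hK⟩ := Set.mem_iUnion₂.1 K.2
    exact Module.finite_of_finrank_pos (hK ▸ hm.1)
  let L : IntermediateField k (AlgebraicClosure k) := ⨆ K : F, K.1
  have : FiniteDimensional k L := IntermediateField.finiteDimensional_iSup_of_finite
  have hroot (a : kˣ) : ∃ b : AlgebraicClosure k, b ^ n = algebraMap k _ (a : k) :=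
    IsAlgClosed.exists_pow_nat_eq _ hn
  choose ρ hρ using hroot
  have hρ0 (a : kˣ) : ρ a ≠ 0 := fun h ↦ by
    have := hρ a
    rw [h, zero_pow hn.ne'] at this
    exact a.ne_zero (by simpa using this.symm)
  have hmem (a : kˣ) : ρ a ∈ L := by
    let f : Polynomial k := Polynomial.X ^ n - Polynomial.C (a : k)
    have hf : f.natDegree = n := Polynomial.natDegree_X_pow_sub_C
    have hf0 : f ≠ 0 := Polynomial.X_pow_sub_C_ne_zero hn _
    have hfr : Polynomial.aeval (ρ a) f = 0 := by simp [f, hρ]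
    have hint : IsIntegral k (ρ a) := Algebra.IsIntegral.isIntegral _
    have hK : IntermediateField.adjoin k {ρ a} ∈ F := by
      refine Set.mem_iUnion₂.2 ⟨_, ⟨minpoly.natDegree_pos hint, ?_⟩,
        IntermediateField.adjoin.finrank hint⟩
      rw [← hf]
      exact Polynomial.natDegree_le_of_dvd (minpoly.dvd k _ hfr) hf0
    exact le_iSup (fun K : F ↦ K.1) ⟨_, hK⟩ (IntermediateField.mem_adjoin_simple_self k _)
  let c (a : kˣ) (σ : L →ₐ[k] AlgebraicClosure k) : rootsOfUnity n (AlgebraicClosure k) :=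
    rootsOfUnity.mkOfPowEq (σ ⟨ρ a, hmem a⟩ / ρ a) (by
      rw [div_pow, ← map_pow, hρ]
      have : (⟨ρ a, hmem a⟩ : L) ^ n = algebraMap k L a := Subtype.ext (hρ a)
      rw [this, AlgHom.commutes, div_self]
      simp)
  have hc (a b : kˣ) (hab : c a = c b) : ∃ u : kˣ, a = b * u ^ n := by
    have hfix : ρ a / ρ b ∈ (⊥ : IntermediateField k (AlgebraicClosure k)) := by
      rw [InfiniteGalois.mem_bot_iff_fixed]
      intro σ
      have h := congrArg (fun z : rootsOfUnity n (AlgebraicClosure k) ↦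
          ((z : (AlgebraicClosure k)ˣ) : AlgebraicClosure k))
        (congrFun hab (σ.toAlgHom.comp L.val))
      have h1 : σ (ρ a) / ρ a = σ (ρ b) / ρ b := by simpa [c] using h
      have := hρ0 a
      have := hρ0 b
      have : σ (ρ b) ≠ 0 := by simpa
      rw [map_div₀]
      field_simp at h1 ⊢
      linear_combination h1
    obtain ⟨u, hu⟩ := IntermediateField.mem_bot.1 hfix
    have h2 : algebraMap k (AlgebraicClosure k) (u ^ n) = algebraMap k _ (a / b : k) := by
      rw [map_pow, hu, div_pow, hρ, hρ, map_div₀]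
    have h3 : u ^ n = a / b := (algebraMap k _).injective h2
    have hu0 : u ≠ 0 := by
      rintro rfl
      rw [zero_pow hn.ne'] at h3
      simp [eq_comm] at h3
    refine ⟨Units.mk0 u hu0, Units.ext ?_⟩
    simp [h3]
    field_simp
  rw [Subgroup.finiteIndex_iff_finite_quotient]
  refine Finite.of_injective (fun x ↦ c x.out) fun x y hxy ↦ ?_
  obtain ⟨u, hu⟩ := hc _ _ hxy
  rw [← x.out_eq', ← y.out_eq', eq_comm]
  refine QuotientGroup.eq.2 ⟨u, ?_⟩
  rw [hu]
  simp

theorem isZEquiv_iff_commute {G : Type*} [Group G] {g h : G} :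
    IsZEquiv g h ↔ ∃ a : G, ∀ x, Commute x g ↔ Commute (a * x * a⁻¹) h := by
  simp only [IsZEquiv, Subgroup.mem_centralizer_singleton_iff, commute_iff_eq]

theorem IsZEquiv.symm {G : Type*} [Group G] {g h : G} (hgh : IsZEquiv g h) : IsZEquiv h g := by
  obtain ⟨a, ha⟩ := hgh
  refine ⟨a⁻¹, fun x ↦ ?_⟩
  rw [ha]
  group

theorem IsZEquiv.trans {G : Type*} [Group G] {f g h : G} (hfg : IsZEquiv f g)
    (hgh : IsZEquiv g h) : IsZEquiv f h := by
  obtain ⟨a, ha⟩ := hfg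
  obtain ⟨b, hb⟩ := hgh
  refine ⟨b * a, fun x ↦ ?_⟩
  rw [ha, hb]
  group

/-- A group has finitely many z-classes if some map to a finite type has z-equivalent elements in
each fibre. -/
theorem finite_zClasses_of_map {G D : Type*} [Group G] [Finite D] (d : G → D)
    (hd : ∀ g h, d g = d h → IsZEquiv g h) :
    {C : Set G | ∃ g, C = {h | IsZEquiv g h}}.Finite := by
  obtain ⟨F, hF⟩ := (Function.factorsThrough_iff (f := d) fun g ↦ {h | IsZEquiv g h}).1
    fun g h hgh ↦ Set.ext fun x ↦ ⟨(hd g h hgh).symm.trans, (hd g h hgh).trans⟩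
  refine (Set.finite_range F).subset ?_
  rintro _ ⟨g, rfl⟩
  exact ⟨d g, (congrFun hF g).symm⟩

namespace Matrix

theorem exists_commute_iff_of_linearEquiv {k : Type*} [Field k] {n : ℕ}
    {A B : Matrix (Fin n) (Fin n) k} (Φ : (Fin n → k) ≃ₗ[k] (Fin n → k))
    (hΦ : ∀ x, Commute x A.toLin' ↔ Commute (Φ.conj x) B.toLin') :
    ∃ P : GL (Fin n) k, ∀ X : Matrix (Fin n) (Fin n) k,
      Commute X A ↔ Commute (P * X * (P⁻¹ : GL (Fin n) k) : Matrix (Fin n) (Fin n) k) B := by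
  have hc (X Y : Matrix (Fin n) (Fin n) k) : Commute X Y ↔ Commute X.toLin' Y.toLin' :=
    (commute_map_iff (f := toLinAlgEquiv' (R := k) (n := Fin n))
      (toLinAlgEquiv' (R := k) (n := Fin n)).injective).symm
  refine ⟨⟨LinearMap.toMatrix' Φ.toLinearMap, LinearMap.toMatrix' Φ.symm.toLinearMap, ?_, ?_⟩,
    fun X ↦ ?_⟩
  · rw [← LinearMap.toMatrix'_comp]; simp
  · rw [← LinearMap.toMatrix'_comp]; simp
  · rw [hc, hc, hΦ, Units.inv_mk, Units.val_mk, Units.val_mk, toLin'_mul, toLin'_mul,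
      toLin'_toMatrix', toLin'_toMatrix', LinearEquiv.conj_apply]

/-- If a matrix whose determinant is an `n`-th power conjugates the centralizer of `g` onto that
of `h`, then `g` and `h` are z-equivalent in `SL n`. -/
theorem SpecialLinearGroup.isZEquiv_of_det_eq_pow {k : Type*} [Field k] {n : ℕ}
    {g h : SpecialLinearGroup (Fin n) k} (P : GL (Fin n) k) (u : kˣ)
    (hu : GeneralLinearGroup.det P = u ^ n)
    (hP : ∀ X : Matrix (Fin n) (Fin n) k, Commute X g ↔
      Commute (P * X * (P⁻¹ : GL (Fin n) k) : Matrix (Fin n) (Fin n) k) h) :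
    IsZEquiv g h := by
  rw [isZEquiv_iff_commute]
  have hdet : det (((u⁻¹ : kˣ) : k) • (P : Matrix (Fin n) (Fin n) k)) = 1 := by
    have := congrArg (Units.val) hu
    rw [GeneralLinearGroup.val_det_apply] at this
    rw [det_smul, this, Fintype.card_fin, Units.val_pow_eq_pow_val, ← mul_pow]
    simp
  let a : SpecialLinearGroup (Fin n) k := ⟨_, hdet⟩
  have hc (x y : SpecialLinearGroup (Fin n) k) : Commute x y ↔
      Commute (x : Matrix (Fin n) (Fin n) k) y :=
    ⟨fun h ↦ congrArg Subtype.val h.eq, fun h ↦ Subtype.ext h.eq⟩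
  refine ⟨a, fun x ↦ ?_⟩
  rw [hc, hc, hP]
  have h1 : ((a * x * a⁻¹ : SpecialLinearGroup (Fin n) k) : Matrix (Fin n) (Fin n) k) * a =
      a * x := by
    rw [← SpecialLinearGroup.coe_mul, ← SpecialLinearGroup.coe_mul, inv_mul_cancel_right]
  have h2 : ((a * x * a⁻¹ : SpecialLinearGroup (Fin n) k) : Matrix (Fin n) (Fin n) k) * P =
      P * x := by
    simp only [a, mul_smul_comm, smul_mul_assoc] at h1
    exact smul_right_injective _ (u⁻¹).ne_zero h1
  rw [← h2, mul_assoc, ← Units.val_mul, mul_inv_cancel, Units.val_one, mul_one]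

end Matrix

/-- If `k` is a perfect field of type (F), i.e. with only finitely many extensions of each
degree inside a fixed algebraic closure, and the characteristic of `k` is zero or does not
divide `n` (very good characteristic for `SL n`), then `SL n k` has only finitely many
z-classes. -/
theorem finitely_many_zClasses_SL_of_typeF (k : Type*) [Field k] [PerfectField k]
    (hk : ∀ m : ℕ, 0 < m →
      {K : IntermediateField k (AlgebraicClosure k) | Module.finrank k K = m}.Finite)
    (n : ℕ) (hn : 0 < n) (hchar : ringChar k = 0 ∨ ¬ (ringChar k ∣ n)) :
    {C : Set (Matrix.SpecialLinearGroup (Fin n) k) |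
      ∃ g : Matrix.SpecialLinearGroup (Fin n) k,
        C = {h : Matrix.SpecialLinearGroup (Fin n) k | IsZEquiv g h}}.Finite := by
  classical
  obtain ⟨s, hs, hcover, hconj⟩ :=
    Module.End.exists_finite_cover_of_typeF (V := Fin n → k) hk
  have := hs.to_subtype
  have := Units.finiteIndex_powMonoidHom_of_typeF hk hn
  have hmem (g : Matrix.SpecialLinearGroup (Fin n) k) : ∃ t : s, g.1.toLin' ∈ t.1 := by
    obtain ⟨t, ht, hg⟩ := Set.mem_sUnion.1 (hcover ▸ Set.mem_univ g.1.toLin')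
    exact ⟨⟨t, ht⟩, hg⟩
  choose t ht using hmem
  let b (g : Matrix.SpecialLinearGroup (Fin n) k) : Matrix.SpecialLinearGroup (Fin n) k :=
    Function.invFun t (t g)
  have htb (g) : t (b g) = t g := Function.invFun_eq ⟨g, rfl⟩
  have hP (g) : ∃ P : GL (Fin n) k, ∀ X : Matrix (Fin n) (Fin n) k,
      Commute X (b g).1 ↔
        Commute (P * X * (P⁻¹ : GL (Fin n) k) : Matrix (Fin n) (Fin n) k) g.1 := by
    obtain ⟨Φ, hΦ⟩ := hconj (t g) (t g).2 _ (htb g ▸ ht (b g)) _ (ht g)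
    exact Matrix.exists_commute_iff_of_linearEquiv Φ hΦ
  choose P hP using hP
  refine finite_zClasses_of_map (D := s × (kˣ ⧸ (powMonoidHom n : kˣ →* kˣ).range))
    (fun g ↦ (t g, Matrix.GeneralLinearGroup.det (P g))) fun g h hgh ↦ ?_
  obtain ⟨h1, h2⟩ := Prod.mk.inj hgh
  obtain ⟨u, hu⟩ := QuotientGroup.eq.1 h2
  refine Matrix.SpecialLinearGroup.isZEquiv_of_det_eq_pow (P h * (P g)⁻¹) u ?_ fun X ↦ ?_
  · rw [map_mul, map_inv, mul_comm]
    exact hu.symm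
  · have h3 := hP g (((P g)⁻¹ : GL (Fin n) k) * X * P g)
    have h4 := hP h (((P g)⁻¹ : GL (Fin n) k) * X * P g)
    have hb : b g = b h := congrArg (Function.invFun t) h1
    rw [hb] at h3
    have h5 := h3.symm.trans h4
    simpa [mul_assoc] using h5
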